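/- Let (X,d) be a compact metric space and f : X → X a continuous map. For any x,y ∈ X and r,b > 0, if x ∈ Sh(f) and y ∈ C(x) ∩ Ent_{r,b}(f), then x ∈ Ent_{s,b}(f) for all 0 < s < r. -/

import Mathlib

open Filter Topology Set

section Defs

variable {X : Type*} [MetricSpace X]

/-- `c 0, c 1, ..., c k` is a `δ`-chain of `f`. -/
def IsDeltaChain (f : X → X) (δ : ℝ) (c : ℕ → X) (k : ℕ) : Prop :=
  ∀ i < k, dist (f (c i)) (c (i + 1)) ≤ δ

/-- `x → y` : for every `δ > 0` there is a `δ`-chain of `f` from `x` to `y`. -/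
def ChainReach (f : X → X) (x y : X) : Prop :=
  ∀ δ > 0, ∃ (c : ℕ → X) (k : ℕ), 1 ≤ k ∧ IsDeltaChain f δ c k ∧ c 0 = x ∧ c k = y

/-- `C(x) = {x} ∪ {y : x → y}`. -/
def CSet (f : X → X) (x : X) : Set X := {x} ∪ {y | ChainReach f x y}

/-- The chain recurrent set. -/
def CR (f : X → X) : Set X := {x | ChainReach f x x}

/-- `C` is a chain component of `f` : an equivalence class of `↔` on `CR f`. -/
def IsChainComponent (f : X → X) (C : Set X) : Prop :=
  ∃ x ∈ CR f, C = {y ∈ CR f | ChainReach f x y ∧ ChainReach f y x}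

/-- A set `S` is chain stable for `f`. -/
def ChainStable (f : X → X) (S : Set X) : Prop :=
  ∀ ε > 0, ∃ δ > 0, ∀ (c : ℕ → X) (k : ℕ), 1 ≤ k → IsDeltaChain f δ c k → c 0 ∈ S →
    ∀ i ≤ k, Metric.infDist (c i) S ≤ ε

/-- `ξ` is a `δ`-pseudo orbit of `f`. -/
def IsPseudoOrbit (f : X → X) (δ : ℝ) (ξ : ℕ → X) : Prop :=
  ∀ i, dist (f (ξ i)) (ξ (i + 1)) ≤ δ

/-- `x` is a shadowable point of `f`. -/
def ShadowablePt (f : X → X) (x : X) : Prop :=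
  ∀ ε > 0, ∃ δ > 0, ∀ ξ : ℕ → X, IsPseudoOrbit f δ ξ → ξ 0 = x →
    ∃ y, ∀ i, dist (f^[i] y) (ξ i) ≤ ε

/-- `f` has the shadowing on `S`. -/
def ShadowingOn (f : X → X) (S : Set X) : Prop :=
  ∀ ε > 0, ∃ δ > 0, ∀ ξ : ℕ → X, IsPseudoOrbit f δ ξ → (∀ i, ξ i ∈ S) →
    ∃ y, ∀ i, dist (f^[i] y) (ξ i) ≤ ε

/-- `f` has the shadowing property. -/
def ShadowingProperty (f : X → X) : Prop :=
  ∀ ε > 0, ∃ δ > 0, ∀ ξ : ℕ → X, IsPseudoOrbit f δ ξ →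
    ∃ y, ∀ i, dist (f^[i] y) (ξ i) ≤ ε

/-- `f` is chain transitive. -/
def ChainTransitive (f : X → X) : Prop := ∀ x y : X, ChainReach f x y

/-- `f` restricted to `S` is chain continuous. -/
def ChainContinuousOn (f : X → X) (S : Set X) : Prop :=
  ∀ ε > 0, ∃ δ > 0, ∀ ξ η : ℕ → X, IsPseudoOrbit f δ ξ → IsPseudoOrbit f δ η →
    (∀ i, ξ i ∈ S) → (∀ i, η i ∈ S) → ξ 0 = η 0 → ∀ i, dist (ξ i) (η i) ≤ ε

/-- `f` restricted to `S` is equicontinuous. -/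
def EquicontinuousOnSet (f : X → X) (S : Set X) : Prop :=
  ∀ ε > 0, ∃ δ > 0, ∀ x ∈ S, ∀ y ∈ S, dist x y ≤ δ → ∀ i : ℕ, dist (f^[i] x) (f^[i] y) ≤ ε

/-- `s_n(f,K,r)` : largest cardinality of an `(n,r)`-separated subset of `K`. -/
noncomputable def sepNum (f : X → X) (K : Set X) (n : ℕ) (r : ℝ) : ℕ :=
  sSup {m | ∃ E : Finset X, (E : Set X) ⊆ K ∧
    (∀ x ∈ E, ∀ y ∈ E, x ≠ y → ∃ i < n, r < dist (f^[i] x) (f^[i] y)) ∧ E.card = m}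

/-- `h(f,K,r) = limsup (1/n) log s_n(f,K,r)`. -/
noncomputable def entH (f : X → X) (K : Set X) (r : ℝ) : EReal :=
  Filter.limsup (fun n : ℕ => ((Real.log (sepNum f K n r) / n : ℝ) : EReal)) Filter.atTop

/-- `h(f,K) = lim_{r → 0} h(f,K,r) = sup_{r > 0} h(f,K,r)`. -/
noncomputable def ent (f : X → X) (K : Set X) : EReal :=
  ⨆ r ∈ Set.Ioi (0 : ℝ), entH f K r

/-- `Ent_r(f)`. -/
def EntR (f : X → X) (r : ℝ) : Set X :=
  {x | ∀ K : Set X, IsClosed K → K ∈ 𝓝 x → 0 < entH f K r}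

/-- `Ent_{r,b}(f)`. -/
def EntRB (f : X → X) (r b : ℝ) : Set X :=
  {x | ∀ K : Set X, IsClosed K → K ∈ 𝓝 x → (b : EReal) ≤ entH f K r}

/-- The ω-limit set of `x` under `f`. -/
def omegaLim (f : X → X) (x : X) : Set X :=
  {y | ∃ φ : ℕ → ℕ, StrictMono φ ∧ Tendsto (fun j => f^[φ j] x) atTop (𝓝 y)}

/-- The set of `e`-sensitive points of `f` restricted to `S`. -/
def SenE (f : X → X) (S : Set X) (e : ℝ) : Set X :=
  {x ∈ S | ∀ ε > 0, ∃ y ∈ S, dist x y ≤ ε ∧ ∃ i : ℕ, e < dist (f^[i] x) (f^[i] y)}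

/-- `Sen(f|_S) = ⋃_{e > 0} Sen_e(f|_S)`. -/
def Sen (f : X → X) (S : Set X) : Set X := ⋃ e ∈ Set.Ioi (0 : ℝ), SenE f S e

/-- `(x,y)` is a scrambled pair for `f`. -/
def ScrambledPair (f : X → X) (x y : X) : Prop :=
  0 < Filter.limsup (fun i : ℕ => dist (f^[i] x) (f^[i] y)) Filter.atTop ∧
    Filter.liminf (fun i : ℕ => dist (f^[i] x) (f^[i] y)) Filter.atTop = 0

/-- `M` is a minimal set for `f`. -/
def IsMinimalSet (f : X → X) (M : Set X) : Prop :=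
  IsClosed M ∧ MapsTo f M M ∧ ∀ S ⊆ M, IsClosed S → MapsTo f S S → S = ∅ ∨ S = M

/-- `Φ_ε(x)`. -/
def Phi (f : X → X) (ε : ℝ) (x : X) : Set X :=
  {y | ∀ i : ℕ, dist (f^[i] x) (f^[i] y) ≤ ε}

/-- `h*_f(ε) = sup_x h(f,Φ_ε(x))`. -/
noncomputable def hStar (f : X → X) (ε : ℝ) : EReal := ⨆ x : X, ent f (Phi f ε x)

/-- `f` is h-expansive. -/
def HExpansive (f : X → X) : Prop := ∃ ε > 0, hStar f ε = 0

end Defs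

theorem bddAbove_card_separated {X : Type*} [MetricSpace X] [CompactSpace X] {f : X → X}
    (hf : Continuous f) (K : Set X) (n : ℕ) {r : ℝ} (hr : 0 < r) :
    BddAbove {m | ∃ E : Finset X, (E : Set X) ⊆ K ∧
      (∀ x ∈ E, ∀ y ∈ E, x ≠ y → ∃ i < n, r < dist (f^[i] x) (f^[i] y)) ∧ E.card = m} := by
  let U : X → Set X := fun x => ⋂ i ∈ Finset.range n, {y | dist (f^[i] x) (f^[i] y) < r / 2}
  have hU : ∀ x, IsOpen (U x) := fun x =>
    isOpen_biInter_finset fun i _ =>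
      isOpen_lt (continuous_const.dist (hf.iterate i)) continuous_const
  have hmem : ∀ x, x ∈ U x := fun x => by
    simp only [U, mem_iInter, mem_ofPred_eq, dist_self]
    exact fun _ _ => half_pos hr
  obtain ⟨t, ht⟩ := isCompact_univ.elim_finite_subcover U hU
    fun x _ => mem_iUnion.2 ⟨x, hmem x⟩
  have hcov : ∀ x, ∃ c ∈ t, x ∈ U c := fun x => by simpa using ht (mem_univ x)
  choose g hgt hgU using hcov
  refine ⟨t.card, ?_⟩
  rintro m ⟨E, -, hE, rfl⟩
  refine Finset.card_le_card_of_injOn g (fun x _ => hgt x) fun x hx y hy hxy => ?_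
  by_contra hne
  obtain ⟨i, hi, hlt⟩ := hE x hx y hy hne
  have h₁ := mem_iInter₂.1 (hgU x) i (Finset.mem_range.2 hi)
  have h₂ := mem_iInter₂.1 (hgU y) i (Finset.mem_range.2 hi)
  rw [← hxy] at h₂
  simp only [mem_ofPred_eq] at h₁ h₂
  linarith [dist_triangle_left (f^[i] x) (f^[i] y) (f^[i] (g x))]

/-- A map that turns `(n, r)`-separation in `L` into `(m, s)`-separation in `K` bounds the
separation numbers. -/
theorem sepNum_le_sepNum {X : Type*} [MetricSpace X] [CompactSpace X] {f : X → X}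
    (hf : Continuous f) {K L : Set X} {n m : ℕ} {r s : ℝ} (hs : 0 < s) (w : X → X)
    (hw : MapsTo w L K)
    (hsep : ∀ x ∈ L, ∀ y ∈ L, (∃ i < n, r < dist (f^[i] x) (f^[i] y)) →
      ∃ i < m, s < dist (f^[i] (w x)) (f^[i] (w y))) :
    sepNum f L n r ≤ sepNum f K m s := by
  classical
  refine csSup_le' ?_
  rintro _ ⟨E, hEL, hE, rfl⟩
  have hinj : InjOn w E := fun x hx y hy hxy => by
    by_contra hne
    obtain ⟨i, -, hi⟩ := hsep x (hEL hx) y (hEL hy) (hE x hx y hy hne)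
    rw [hxy, dist_self] at hi
    exact hs.not_gt hi
  refine le_csSup (bddAbove_card_separated hf K m hs)
    ⟨E.image w, ?_, ?_, Finset.card_image_of_injOn hinj⟩
  · rw [Finset.coe_image]
    exact (hw.mono_left hEL).image_subset
  · intro a ha b hb hab
    obtain ⟨x, hx, rfl⟩ := Finset.mem_image.1 ha
    obtain ⟨y, hy, rfl⟩ := Finset.mem_image.1 hb
    exact hsep x (hEL hx) y (hEL hy) (hE x hx y hy (ne_of_apply_ne w hab))

theorem limsup_log_div_le_of_le_shift {A B : ℕ → ℕ} (k : ℕ) (h : ∀ n, A n ≤ B (n + k)) :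
    limsup (fun n : ℕ => ((Real.log (A n) / n : ℝ) : EReal)) atTop ≤
      limsup (fun n : ℕ => ((Real.log (B n) / n : ℝ) : EReal)) atTop := by
  refine le_of_forall_lt fun c hc => ?_
  obtain ⟨p, hcp, hp⟩ := EReal.lt_iff_exists_real_btwn.1 hc
  obtain ⟨q, hpq, hq⟩ := EReal.lt_iff_exists_real_btwn.1 hp
  refine hcp.trans_le (le_limsup_of_frequently_le ?_)
  have hpq' : 0 < q - p := sub_pos.2 (EReal.coe_lt_coe_iff.1 hpq)
  obtain ⟨N, hN⟩ := exists_nat_ge (p * k / (q - p))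
  have hfreq := (frequently_lt_of_lt_limsup (by isBoundedDefault) hq).and_eventually
    (eventually_ge_atTop (max N 1))
  refine (tendsto_add_atTop_nat k).frequently (hfreq.mono ?_)
  rintro n ⟨hqn, hn⟩
  have hn1 : (0 : ℝ) < n := by exact_mod_cast (le_max_right N 1).trans hn
  have hNn : (N : ℝ) ≤ n := by exact_mod_cast (le_max_left N 1).trans hn
  rw [EReal.coe_lt_coe_iff, lt_div_iff₀ hn1] at hqn
  have hlog : Real.log (A n) ≤ Real.log (B (n + k)) := by
    rcases Nat.eq_zero_or_pos (A n) with h0 | hpos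
    · simpa [h0] using Real.log_natCast_nonneg (B (n + k))
    · exact Real.log_le_log (by exact_mod_cast hpos) (by exact_mod_cast h n)
  have hpk := (div_le_iff₀ hpq').1 (hN.trans hNn)
  rw [EReal.coe_le_coe_iff, le_div_iff₀ (by push_cast; positivity)]
  push_cast
  linarith

/-- The `δ`-chain `c` from `c 0` to near `z`, continued by the orbit of `z` from time `k` on,
is a pseudo orbit. -/
theorem IsDeltaChain.isPseudoOrbit_append {X : Type*} [MetricSpace X] {f : X → X} {δ η : ℝ}
    {c : ℕ → X} {k : ℕ} (hc : IsDeltaChain f δ c k) (hδ : 0 ≤ δ) {z : X}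
    (hz : dist z (c k) ≤ η) :
    IsPseudoOrbit f (δ + η) fun i => if i < k then c i else f^[i - k] z := by
  have hη : 0 ≤ η := dist_nonneg.trans hz
  intro i
  rcases lt_trichotomy (i + 1) k with hi | hi | hi
  · simp only [hi, (Nat.lt_succ_self i).trans hi, if_true]
    linarith [hc i (by omega)]
  · subst hi
    simp only [Nat.lt_succ_self, lt_irrefl, if_true, if_false, Nat.sub_self,
      Function.iterate_zero, id_eq]
    linarith [hc i (by omega), dist_triangle_right (f (c i)) z (c (i + 1))]
  · have hik : ¬ i < k := by omega
    have hik' : ¬ i + 1 < k := by omega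
    simp only [hik, hik', if_false]
    rw [Nat.sub_add_comm (by omega), Function.iterate_succ_apply', dist_self]
    linarith

/-- Lemma 3.1 (2): if `x ∈ Sh(f)` and `y ∈ C(x) ∩ Ent_{r,b}(f)`, then
`x ∈ Ent_{s,b}(f)` for all `0 < s < r`. -/
theorem stmt_11 {X : Type*} [MetricSpace X] [CompactSpace X] (f : X → X)
    (hf : Continuous f) (x y : X) (r b : ℝ) (hr : 0 < r) (hb : 0 < b)
    (hx : ShadowablePt f x) (hy : y ∈ CSet f x ∩ EntRB f r b) :
    ∀ s : ℝ, 0 < s → s < r → x ∈ EntRB f s b := by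
  rintro s hs hsr K hK hKx
  obtain ⟨rfl | hreach, hyE⟩ := hy
  · refine (hyE K hK hKx).trans (limsup_log_div_le_of_le_shift 0 fun n => ?_)
    exact sepNum_le_sepNum hf hs id (mapsTo_id K)
      fun _ _ _ _ ⟨i, hi, hlt⟩ => ⟨i, hi, hsr.trans hlt⟩
  · obtain ⟨ρ, hρ, hρK⟩ := Metric.nhds_basis_closedBall.mem_iff.1 hKx
    obtain ⟨δ, hδ, hsh⟩ := hx (min ρ ((r - s) / 2)) (lt_min hρ (by linarith))
    obtain ⟨c, k, hk, hc, rfl, rfl⟩ := hreach (δ / 2) (half_pos hδ)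
    have hshadow : ∀ z ∈ Metric.closedBall (c k) (δ / 2), ∃ w ∈ K,
        ∀ i, dist (f^[i + k] w) (f^[i] z) ≤ (r - s) / 2 := by
      intro z hz
      have hpo := hc.isPseudoOrbit_append (half_pos hδ).le hz
      rw [add_halves] at hpo
      obtain ⟨w, hw⟩ := hsh _ hpo (if_pos hk)
      refine ⟨w, hρK ?_, fun i => ?_⟩
      · simpa [Nat.lt_of_succ_le hk] using (hw 0).trans (min_le_left _ _)
      · simpa using (hw (i + k)).trans (min_le_right _ _)
    choose! w hwK hw using hshadow
    refine (hyE _ Metric.isClosed_closedBall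
      (Metric.closedBall_mem_nhds _ (half_pos hδ))).trans
      (limsup_log_div_le_of_le_shift k fun n => sepNum_le_sepNum hf hs w hwK ?_)
    rintro z hz z' hz' ⟨i, hi, hlt⟩
    refine ⟨i + k, by omega, ?_⟩
    have h₁ := hw z hz i
    have h₂ := hw z' hz' i
    have h₃ := dist_triangle4 (f^[i] z) (f^[i + k] (w z)) (f^[i + k] (w z')) (f^[i] z')
    rw [dist_comm (f^[i] z) (f^[i + k] (w z))] at h₃
    linarith
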